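/- Let m = a + b + 1 ≥ 2, n ≥ 2, ζ = exp(2πi/n), u_k = 1/(1-ζ^k). Then the real part of Σ_{1≤i₁<…<i_m≤n-1} u_{i₁}⋯u_{i_a}·u_{i_{a+1}}²·u_{i_{a+2}}⋯u_{i_m} equals -(m!·(n-2m-3)/(2·(m+2)!))·C(n-1,m); in particular it depends only on m and n, not on the choice of a and b. -/

import Mathlib

open Complex Finset
open scoped Classical

open Polynomial in
/-- The polynomial `(X - z) (X - z ^ 2) ⋯ (X - z ^ (j - 1))`. -/
noncomputable def qFallingPoly (z : ℂ) (j : ℕ) : ℂ[X] := ∏ k ∈ Ico 1 j, (X - C (z ^ k))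

open Polynomial in
/-- The generating polynomial of the elementary symmetric functions of `v 1, …, v (j - 1)`. -/
noncomputable def esymmPoly (v : ℕ → ℂ) (j : ℕ) : ℂ[X] := ∏ k ∈ Ico 1 j, (1 + C (v k) * X)

/-- The strictly increasing `m`-tuples in `{1, …, N}`. -/
noncomputable def strictMonoTuples (N m : ℕ) : Finset (Fin m → ℕ) :=
  (Fintype.piFinset fun _ : Fin m => Finset.Icc 1 N).filter (fun i => StrictMono i)

lemma mem_strictMonoTuples {N m : ℕ} {i : Fin m → ℕ} :
    i ∈ strictMonoTuples N m ↔ (∀ r, 1 ≤ i r ∧ i r ≤ N) ∧ StrictMono i := by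
  simp [strictMonoTuples, Fintype.mem_piFinset]

lemma sum_strictMonoTuples_succ (w : ℕ → ℕ → ℂ) (N m : ℕ) :
    ∑ i ∈ strictMonoTuples (N + 1) (m + 1), ∏ r : Fin (m + 1), w r (i r) =
      ∑ i ∈ strictMonoTuples N (m + 1), ∏ r : Fin (m + 1), w r (i r) +
        (∑ i ∈ strictMonoTuples N m, ∏ r : Fin m, w r (i r)) * w m (N + 1) := by
  rw [← sum_filter_add_sum_filter_not (strictMonoTuples (N + 1) (m + 1))
    (fun i => i (Fin.last m) ≤ N)]
  congr 1
  · refine sum_congr ?_ fun _ _ => rfl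
    ext i
    simp only [mem_filter, mem_strictMonoTuples]
    constructor
    · rintro ⟨⟨h, hi⟩, hl⟩
      exact ⟨fun r => ⟨(h r).1, (hi.monotone (Fin.le_last r)).trans hl⟩, hi⟩
    · rintro ⟨h, hi⟩
      exact ⟨⟨fun r => ⟨(h r).1, (h r).2.trans (Nat.le_succ N)⟩, hi⟩, (h _).2⟩
  · rw [sum_mul]
    refine sum_bij' (fun i _ => fun r : Fin m => i r.castSucc)
      (fun i _ => (Fin.snoc i (N + 1) : Fin (m + 1) → ℕ)) ?_ ?_ ?_ ?_ ?_
    · intro i hi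
      simp only [mem_filter, mem_strictMonoTuples, not_le] at hi ⊢
      obtain ⟨⟨h, hi⟩, hl⟩ := hi
      refine ⟨fun r => ⟨(h _).1, ?_⟩, fun r s hrs => hi (by simpa using hrs)⟩
      have := hi (Fin.castSucc_lt_last r)
      have := (h (Fin.last m)).2
      omega
    · intro i hi
      simp only [mem_filter, mem_strictMonoTuples, not_le] at hi ⊢
      obtain ⟨h, hi⟩ := hi
      refine ⟨⟨fun r => ?_, fun r s hrs => ?_⟩, by simp⟩
      · induction r using Fin.lastCases with
        | last => simp
        | cast r => simpa using ⟨(h r).1, (h r).2.trans (Nat.le_succ N)⟩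
      · induction s using Fin.lastCases with
        | last =>
          induction r using Fin.lastCases with
          | last => exact absurd hrs (lt_irrefl _)
          | cast r => simpa using Nat.lt_succ_of_le (h r).2
        | cast s =>
          induction r using Fin.lastCases with
          | last => exact absurd (hrs.trans (Fin.castSucc_lt_last s)) (lt_irrefl _)
          | cast r => simpa using hi (by simpa using hrs)
    · intro i hi
      simp only [mem_filter, mem_strictMonoTuples, not_le] at hi
      have hl : i (Fin.last m) = N + 1 := le_antisymm (hi.1.1 _).2 hi.2
      rw [← hl]
      exact Fin.snoc_init_self i
    · intro i _
      ext r
      simp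
    · intro i hi
      simp only [mem_filter, mem_strictMonoTuples, not_le] at hi
      have hl : i (Fin.last m) = N + 1 := le_antisymm (hi.1.1 _).2 hi.2
      rw [Fin.prod_univ_castSucc, hl]
      simp

lemma strictMonoTuples_zero_succ (m : ℕ) : strictMonoTuples 0 (m + 1) = ∅ := by
  refine eq_empty_of_forall_notMem fun i hi => ?_
  have := (mem_strictMonoTuples.1 hi).1 0
  omega

lemma sum_strictMonoTuples_zero (w : ℕ → ℕ → ℂ) (N : ℕ) :
    ∑ i ∈ strictMonoTuples N 0, ∏ r : Fin 0, w r (i r) = 1 := by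
  have : strictMonoTuples N 0 = univ := by
    ext i
    simp only [mem_strictMonoTuples, mem_univ, iff_true]
    exact ⟨fun r => r.elim0, Subsingleton.strictMono i⟩
  simp [this]

lemma coeff_mul_one_add_C_mul_X (f : Polynomial ℂ) (c : ℂ) (k : ℕ) :
    (f * (1 + Polynomial.C c * Polynomial.X)).coeff (k + 1) = f.coeff (k + 1) + c * f.coeff k := by
  have : f * (1 + Polynomial.C c * Polynomial.X) = f + Polynomial.C c * (f * Polynomial.X) := by
    ring
  rw [this, Polynomial.coeff_add, Polynomial.coeff_C_mul, Polynomial.coeff_mul_X]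

lemma coeff_mul_one_add_C_mul_X_zero (f : Polynomial ℂ) (c : ℂ) :
    (f * (1 + Polynomial.C c * Polynomial.X)).coeff 0 = f.coeff 0 := by
  simp [Polynomial.mul_coeff_zero]

lemma esymmPoly_succ (v : ℕ → ℂ) {j : ℕ} (hj : 1 ≤ j) :
    esymmPoly v (j + 1) = esymmPoly v j * (1 + Polynomial.C (v j) * Polynomial.X) := by
  rw [esymmPoly, prod_Ico_succ_top hj, esymmPoly]

lemma sum_strictMonoTuples_eq_coeff_esymmPoly (u : ℕ → ℂ) (a N : ℕ) {m : ℕ} (hm : m ≤ a) :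
    ∑ i ∈ strictMonoTuples N m, ∏ r : Fin m, u (i r) ^ (if (r : ℕ) = a then 2 else 1) =
      (esymmPoly u (N + 1)).coeff m := by
  induction N generalizing m with
  | zero =>
    cases m with
    | zero =>
      rw [sum_strictMonoTuples_zero (fun r k => u k ^ (if r = a then 2 else 1))]
      simp [esymmPoly]
    | succ m =>
      rw [strictMonoTuples_zero_succ]
      simp [esymmPoly, Polynomial.coeff_one]
  | succ N ih =>
    rw [esymmPoly_succ u (Nat.le_add_left 1 N)]
    cases m with
    | zero =>
      rw [sum_strictMonoTuples_zero (fun r k => u k ^ (if r = a then 2 else 1)),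
        coeff_mul_one_add_C_mul_X_zero, ← ih hm,
        sum_strictMonoTuples_zero (fun r k => u k ^ (if r = a then 2 else 1))]
    | succ m =>
      rw [sum_strictMonoTuples_succ (fun r k => u k ^ (if r = a then 2 else 1)), ih hm,
        ih (Nat.le_of_succ_le hm), coeff_mul_one_add_C_mul_X, if_neg (by omega)]
      ring

lemma sum_strictMonoTuples_eq_sum_coeff (u : ℕ → ℂ) (a b N : ℕ) :
    ∑ i ∈ strictMonoTuples N (a + b + 1),
        ∏ r : Fin (a + b + 1), u (i r) ^ (if (r : ℕ) = a then 2 else 1) =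
      ∑ j ∈ Ico 1 (N + 1), u j ^ 2 * (esymmPoly u j).coeff a *
        (∏ k ∈ Ico (j + 1) (N + 1), (1 + Polynomial.C (u k) * Polynomial.X)).coeff b := by
  induction N generalizing b with
  | zero => simp [strictMonoTuples_zero_succ]
  | succ N ih =>
    rw [sum_strictMonoTuples_succ (fun r k => u k ^ (if r = a then 2 else 1)), ih,
      sum_Ico_succ_top (Nat.le_add_left 1 N)]
    have hstep : ∀ j ∈ Ico 1 (N + 1),
        (∏ k ∈ Ico (j + 1) (N + 1 + 1), (1 + Polynomial.C (u k) * Polynomial.X)) =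
        (∏ k ∈ Ico (j + 1) (N + 1), (1 + Polynomial.C (u k) * Polynomial.X)) *
          (1 + Polynomial.C (u (N + 1)) * Polynomial.X) := by
      intro j hj
      rw [prod_Ico_succ_top]
      rw [mem_Ico] at hj
      omega
    cases b with
    | zero =>
      rw [sum_strictMonoTuples_eq_coeff_esymmPoly u a N (by simp)]
      congr 1
      · refine sum_congr rfl fun j hj => ?_
        rw [hstep j hj, coeff_mul_one_add_C_mul_X_zero]
      · simp
        ring
    | succ b =>
      rw [show a + (b + 1) = a + b + 1 by ring, ih, if_neg (by omega), Ico_self, prod_empty,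
        Polynomial.coeff_one, if_neg (by omega), mul_zero, add_zero, sum_mul, ← sum_add_distrib]
      refine sum_congr rfl fun j hj => ?_
      rw [hstep j hj, coeff_mul_one_add_C_mul_X]
      ring

lemma esymmPoly_reflect (v : ℕ → ℂ) {j n : ℕ} (hj : j ≤ n) :
    esymmPoly (fun k => v (n - k)) (n - j) =
      ∏ k ∈ Ico (j + 1) n, (1 + Polynomial.C (v k) * Polynomial.X) := by
  rw [esymmPoly, prod_Ico_reflect (fun k => 1 + Polynomial.C (v k) * Polynomial.X) 1 (by omega)]
  congr 2
  omega

lemma qFallingPoly_succ (z : ℂ) {j : ℕ} (hj : 1 ≤ j) :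
    qFallingPoly z (j + 1) = qFallingPoly z j * (Polynomial.X - Polynomial.C (z ^ j)) := by
  rw [qFallingPoly, prod_Ico_succ_top hj, qFallingPoly]

lemma qFallingPoly_one (z : ℂ) : qFallingPoly z 1 = 1 := by simp [qFallingPoly]

lemma coeff_succ_qFallingPoly_succ (z : ℂ) {j : ℕ} (hj : 1 ≤ j) (p : ℕ) :
    (qFallingPoly z (j + 1)).coeff (p + 1) =
      (qFallingPoly z j).coeff p - z ^ j * (qFallingPoly z j).coeff (p + 1) := by
  rw [qFallingPoly_succ z hj, Polynomial.coeff_mul_X_sub_C, mul_comm (z ^ j)]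

lemma natDegree_qFallingPoly (z : ℂ) (j : ℕ) : (qFallingPoly z j).natDegree ≤ j - 1 := by
  refine (Polynomial.natDegree_prod_le _ _).trans ?_
  simp only [Polynomial.natDegree_X_sub_C]
  simp

lemma qFallingPoly_comp_C_mul_X (z : ℂ) {j : ℕ} (hj : 1 ≤ j) :
    (qFallingPoly z (j + 1)).comp (Polynomial.C z * Polynomial.X) =
      Polynomial.C (z ^ j) * (Polynomial.X - 1) * qFallingPoly z j := by
  induction j, hj using Nat.le_induction with
  | base =>
    simp [qFallingPoly_succ z le_rfl, qFallingPoly_one]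
    ring
  | succ j hj ih =>
    rw [qFallingPoly_succ z (Nat.le_succ_of_le hj), Polynomial.mul_comp, ih, qFallingPoly_succ z hj]
    rw [Polynomial.sub_comp, Polynomial.X_comp, Polynomial.C_comp, pow_succ, Polynomial.C_mul]
    ring

/-- The `q`-derivative of `qFallingPoly z (j + 1)` is a multiple of `qFallingPoly z j`. -/
lemma one_sub_pow_mul_coeff_qFallingPoly (z : ℂ) {j : ℕ} (hj : 1 ≤ j) (p : ℕ) :
    (1 - z ^ (p + 1)) * (qFallingPoly z (j + 1)).coeff (p + 1) =
      (1 - z ^ j) * (qFallingPoly z j).coeff p := by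
  have h := congrArg (fun f => Polynomial.coeff f (p + 1)) (qFallingPoly_comp_C_mul_X z hj)
  simp only [Polynomial.comp_C_mul_X_coeff, mul_assoc, Polynomial.coeff_C_mul, sub_mul, one_mul,
    Polynomial.coeff_sub, Polynomial.coeff_X_mul] at h
  linear_combination coeff_succ_qFallingPoly_succ z hj p - h

/-- The coefficient of `X ^ p * Y ^ q` in
`∑ j, g j * ∏ k < j, (X - z ^ k) * ∏ k > j, (Y - z ^ k)`, for `z` an `n`-th root of unity. -/
noncomputable def splitCoeff (z : ℂ) (n : ℕ) (g : ℕ → ℂ) (p q : ℕ) : ℂ :=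
  ∑ j ∈ Ico 1 n, g j * ((qFallingPoly z j).coeff p * (qFallingPoly z⁻¹ (n - j)).coeff q)

lemma inv_pow_sub_eq {z : ℂ} {n : ℕ} (hz : z ^ n = 1) {j : ℕ} (hj : j ≤ n) :
    z⁻¹ ^ (n - j) = z ^ j := by
  have h : z ^ (n - j) * z ^ j = 1 := by rw [← pow_add, Nat.sub_add_cancel hj, hz]
  rw [inv_pow]
  exact inv_eq_of_mul_eq_one_right h

lemma splitCoeff_sub {z : ℂ} {n : ℕ} (hz : z ^ n = 1) (g : ℕ → ℂ) (p q : ℕ) :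
    splitCoeff z n g p (q + 1) - splitCoeff z n g (p + 1) q =
      ∑ j ∈ Ico 1 n, g j *
        ((qFallingPoly z (j + 1)).coeff (p + 1) * (qFallingPoly z⁻¹ (n - j)).coeff (q + 1) -
          (qFallingPoly z j).coeff (p + 1) * (qFallingPoly z⁻¹ (n - j + 1)).coeff (q + 1)) := by
  rw [splitCoeff, splitCoeff, ← sum_sub_distrib]
  refine sum_congr rfl fun j hj => ?_
  rw [mem_Ico] at hj
  rw [coeff_succ_qFallingPoly_succ z hj.1, coeff_succ_qFallingPoly_succ z⁻¹ (by omega),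
    inv_pow_sub_eq hz hj.2.le]
  ring

lemma splitCoeff_one_succ {z : ℂ} {n : ℕ} (hn : 1 ≤ n) (hz : z ^ n = 1) (p q : ℕ) :
    splitCoeff z n (fun _ => 1) (p + 1) q = splitCoeff z n (fun _ => 1) p (q + 1) := by
  symm
  rw [← sub_eq_zero, splitCoeff_sub hz]
  have h := sum_Ico_sub (fun j => (qFallingPoly z j).coeff (p + 1) *
    (qFallingPoly z⁻¹ (n + 1 - j)).coeff (q + 1)) hn
  have h0 : n + 1 - n = 1 := by omega
  simp only [h0, qFallingPoly_one, Polynomial.coeff_one, Nat.succ_ne_zero, if_false, mul_zero, zero_mul, sub_zero] at h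
  rw [← h]
  refine sum_congr rfl fun j hj => ?_
  rw [mem_Ico] at hj
  rw [one_mul, show n + 1 - (j + 1) = n - j by omega, show n + 1 - j = n - j + 1 by omega]

lemma eq_zero_add_of_succ_eq {f : ℕ → ℕ → ℂ} (h : ∀ p q, f (p + 1) q = f p (q + 1)) (p q : ℕ) :
    f p q = f 0 (p + q) := by
  induction p generalizing q with
  | zero => simp
  | succ p ih => rw [h, ih, add_assoc, add_comm 1 q]

lemma splitCoeff_eq_zero_left (z : ℂ) {n : ℕ} (g : ℕ → ℂ) {p : ℕ} (hp : n ≤ p + 1) (q : ℕ) :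
    splitCoeff z n g p q = 0 := by
  refine sum_eq_zero fun j hj => ?_
  rw [mem_Ico] at hj
  rw [Polynomial.coeff_eq_zero_of_natDegree_lt
    ((natDegree_qFallingPoly z j).trans_lt (by omega)), zero_mul, mul_zero]

lemma splitCoeff_eq_zero_right (z : ℂ) {n : ℕ} (g : ℕ → ℂ) (p : ℕ) {q : ℕ} (hq : n ≤ q + 1) :
    splitCoeff z n g p q = 0 := by
  refine sum_eq_zero fun j hj => ?_
  rw [mem_Ico] at hj
  rw [Polynomial.coeff_eq_zero_of_natDegree_lt
    ((natDegree_qFallingPoly z⁻¹ (n - j)).trans_lt (by omega)), mul_zero, mul_zero]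

lemma one_sub_pow_ne_zero {z : ℂ} {n : ℕ} (hz : IsPrimitiveRoot z n) {k : ℕ} (h1 : 1 ≤ k)
    (hk : k < n) : 1 - z ^ k ≠ 0 :=
  sub_ne_zero.2 (hz.pow_ne_one_of_pos_of_lt (by omega) hk).symm

lemma one_div_one_sub_inv_pow {z : ℂ} {k : ℕ} (h0 : z ≠ 0) (hk : 1 - z ^ k ≠ 0) :
    1 / (1 - z⁻¹ ^ k) = 1 - 1 / (1 - z ^ k) := by
  have h : z ^ k ≠ 0 := pow_ne_zero k h0
  have h' : z ^ k - 1 ≠ 0 := by rwa [← neg_sub, neg_ne_zero]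
  rw [inv_pow, show 1 - (z ^ k)⁻¹ = (z ^ k - 1) / z ^ k by field_simp, one_div_div,
    show z ^ k - 1 = -(1 - z ^ k) by ring]
  field_simp
  ring

lemma splitCoeff_sub_eq {z : ℂ} {n : ℕ} (hn : 1 ≤ n) (hz : IsPrimitiveRoot z n) {p q : ℕ}
    (hp : p + 1 < n) (hq : q + 1 < n) :
    splitCoeff z n (fun j => 1 / (1 - z ^ j)) p (q + 1) -
        splitCoeff z n (fun j => 1 / (1 - z ^ j)) (p + 1) q =
      splitCoeff z n (fun _ => 1) p (q + 1) *
        (1 / (1 - z ^ (p + 1)) + 1 / (1 - z ^ (q + 1)) - 1) := by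
  have hz0 : z ≠ 0 := hz.ne_zero (by omega)
  have hp0 := one_sub_pow_ne_zero hz (Nat.le_add_left 1 p) hp
  have hq0 := one_sub_pow_ne_zero hz (Nat.le_add_left 1 q) hq
  have hq1 := one_div_one_sub_inv_pow hz0 hq0
  have hq2 : 1 - z⁻¹ ^ (q + 1) ≠ 0 := by
    rw [inv_pow, sub_ne_zero]
    intro h
    exact hq0 (by rw [← inv_inv (z ^ (q + 1)), ← h]; simp)
  rw [splitCoeff_sub hz.pow_eq_one]
  trans (∑ j ∈ Ico 1 n, (1 / (1 - z ^ (p + 1)) * (1 *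
      ((qFallingPoly z j).coeff p * (qFallingPoly z⁻¹ (n - j)).coeff (q + 1))) -
    1 / (1 - z⁻¹ ^ (q + 1)) * (1 *
      ((qFallingPoly z j).coeff (p + 1) * (qFallingPoly z⁻¹ (n - j)).coeff q))))
  · refine sum_congr rfl fun j hj => ?_
    rw [mem_Ico] at hj
    have hj0 := one_sub_pow_ne_zero hz hj.1 hj.2
    have h1 : (qFallingPoly z (j + 1)).coeff (p + 1) =
        (1 - z ^ j) * (qFallingPoly z j).coeff p / (1 - z ^ (p + 1)) := by
      rw [eq_div_iff hp0, mul_comm, one_sub_pow_mul_coeff_qFallingPoly z hj.1]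
    have h2 : (qFallingPoly z⁻¹ (n - j + 1)).coeff (q + 1) =
        (1 - z ^ j) * (qFallingPoly z⁻¹ (n - j)).coeff q / (1 - z⁻¹ ^ (q + 1)) := by
      rw [eq_div_iff hq2, mul_comm, one_sub_pow_mul_coeff_qFallingPoly z⁻¹ (by omega),
        inv_pow_sub_eq hz.pow_eq_one hj.2.le]
    rw [h1, h2]
    field_simp
  · rw [sum_sub_distrib, ← mul_sum (a := 1 / (1 - z ^ (p + 1))),
      ← mul_sum (a := 1 / (1 - z⁻¹ ^ (q + 1)))]
    change _ * splitCoeff z n (fun _ => 1) p (q + 1) -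
      _ * splitCoeff z n (fun _ => 1) (p + 1) q = _
    rw [splitCoeff_one_succ hn hz.pow_eq_one, hq1]
    ring

lemma splitCoeff_symm_succ {z : ℂ} {n : ℕ} (hn : 1 ≤ n) (hz : IsPrimitiveRoot z n) (p q : ℕ) :
    splitCoeff z n (fun j => 1 / (1 - z ^ j)) (p + 1) q +
        splitCoeff z n (fun j => 1 / (1 - z ^ j)) q (p + 1) =
      splitCoeff z n (fun j => 1 / (1 - z ^ j)) p (q + 1) +
        splitCoeff z n (fun j => 1 / (1 - z ^ j)) (q + 1) p := by
  by_cases hp : p + 1 < n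
  · by_cases hq : q + 1 < n
    · have h1 := splitCoeff_sub_eq hn hz hp hq
      have h2 := splitCoeff_sub_eq hn hz hq hp
      have h3 := eq_zero_add_of_succ_eq (splitCoeff_one_succ hn hz.pow_eq_one)
      rw [h3, show p + (q + 1) = p + q + 1 by ring] at h1
      rw [h3, show q + (p + 1) = p + q + 1 by ring] at h2
      linear_combination h2 - h1
    · rw [splitCoeff_eq_zero_left z _ (p := q) (by omega),
        splitCoeff_eq_zero_left z _ (p := q + 1) (by omega),
        splitCoeff_eq_zero_right z _ _ (q := q) (by omega),
        splitCoeff_eq_zero_right z _ _ (q := q + 1) (by omega)]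
  · rw [splitCoeff_eq_zero_left z _ (p := p) (by omega),
      splitCoeff_eq_zero_left z _ (p := p + 1) (by omega),
      splitCoeff_eq_zero_right z _ _ (q := p) (by omega),
      splitCoeff_eq_zero_right z _ _ (q := p + 1) (by omega)]

lemma sum_antidiagonal_choose_mul_choose (N a b : ℕ) :
    ∑ x ∈ antidiagonal N, x.1.choose a * x.2.choose b = (N + 1).choose (a + b + 1) := by
  induction N generalizing a with
  | zero =>
    cases a <;> cases b <;> simp [Nat.choose_eq_zero_of_lt, ← add_assoc]
  | succ N ih =>
    cases a with
    | zero =>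
      rw [Nat.sum_antidiagonal_succ]
      have := ih 0
      simp only [Nat.choose_zero_right, one_mul, zero_add] at this ⊢
      rw [this, Nat.choose_succ_succ (N + 1)]
    | succ a =>
      rw [Nat.sum_antidiagonal_succ]
      simp only [Nat.choose_succ_succ _ a, add_mul, sum_add_distrib]
      rw [ih a, ih (a + 1), show a + 1 + b + 1 = a + b + 1 + 1 by ring,
        Nat.choose_succ_succ (N + 1)]
      simp

lemma coeff_comp_X_add_one {f : Polynomial ℂ} {n : ℕ} (hf : f.natDegree < n) (a : ℕ) :
    (f.comp (Polynomial.X + 1)).coeff a = ∑ p ∈ range n, f.coeff p * (p.choose a : ℂ) := by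
  conv_lhs => rw [f.as_sum_range_C_mul_X_pow' hf]
  simp [Polynomial.coeff_X_add_one_pow]

lemma qFallingPoly_comp_X_add_one {z : ℂ} {j : ℕ} (h : ∀ k ∈ Ico 1 j, 1 - z ^ k ≠ 0) :
    (qFallingPoly z j).comp (Polynomial.X + 1) =
      Polynomial.C (∏ k ∈ Ico 1 j, (1 - z ^ k)) * esymmPoly (fun k => 1 / (1 - z ^ k)) j := by
  rw [qFallingPoly, esymmPoly, Polynomial.prod_comp, map_prod, ← prod_mul_distrib]
  refine prod_congr rfl fun k hk => ?_
  rw [mul_add, ← mul_assoc, ← Polynomial.C_mul, mul_one_div_cancel (h k hk)]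
  simp
  ring

lemma qFallingPoly_eq_geom_sum {z : ℂ} {n : ℕ} (hn : 1 ≤ n) (hz : IsPrimitiveRoot z n) :
    qFallingPoly z n = ∑ i ∈ range n, (Polynomial.X : Polynomial ℂ) ^ i := by
  have h := X_pow_sub_C_eq_prod hz hn (one_pow n)
  rw [range_eq_Ico, prod_eq_prod_Ico_succ_bot hn] at h
  have h2 := geom_sum_mul (Polynomial.X : Polynomial ℂ) n
  refine mul_right_cancel₀ (Polynomial.X_sub_C_ne_zero (1 : ℂ)) ?_
  rw [map_one, h2, ← map_one Polynomial.C, h, qFallingPoly]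
  simp [mul_comm]

lemma prod_one_sub_pow_eq {z : ℂ} {n : ℕ} (hn : 1 ≤ n) (hz : IsPrimitiveRoot z n) :
    ∏ k ∈ Ico 1 n, (1 - z ^ k) = n := by
  have h := congrArg (Polynomial.eval 1) (qFallingPoly_eq_geom_sum hn hz)
  simpa [qFallingPoly, Polynomial.eval_prod, Polynomial.eval_finsetSum] using h

lemma coeff_esymmPoly_eq {z : ℂ} {n : ℕ} (hn : 1 ≤ n) (hz : IsPrimitiveRoot z n) (m : ℕ) :
    (n : ℂ) * (esymmPoly (fun k => 1 / (1 - z ^ k)) n).coeff m = n.choose (m + 1) := by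
  have h := qFallingPoly_comp_X_add_one (z := z) (j := n) fun k hk =>
    one_sub_pow_ne_zero hz (mem_Ico.1 hk).1 (mem_Ico.1 hk).2
  rw [prod_one_sub_pow_eq hn hz] at h
  rw [← Polynomial.coeff_C_mul, ← h, coeff_comp_X_add_one (n := n)
    ((natDegree_qFallingPoly z n).trans_lt (by omega)), qFallingPoly_eq_geom_sum hn hz]
  have h3 := sum_antidiagonal_choose_mul_choose (n - 1) m 0
  rw [Nat.sum_antidiagonal_eq_sum_range_succ_mk, Nat.succ_eq_add_one, Nat.sub_add_cancel hn,
    add_zero] at h3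
  rw [← h3]
  push_cast
  refine sum_congr rfl fun p hp => ?_
  rw [mem_range] at hp
  simp [Polynomial.coeff_X_pow, hp]

/-- The sum of `(∏ r, v (i r)) * v (i a)` over increasing sequences `i` in `{1, …, n - 1}` with
`a` terms before and `b` terms after the distinguished one. -/
noncomputable def squareSum (v : ℕ → ℂ) (n a b : ℕ) : ℂ :=
  ∑ j ∈ Ico 1 n, v j ^ 2 * (esymmPoly v j).coeff a *
    (∏ k ∈ Ico (j + 1) n, (1 + Polynomial.C (v k) * Polynomial.X)).coeff b

lemma esymmPoly_congr {v w : ℕ → ℂ} {j : ℕ} (h : ∀ k ∈ Ico 1 j, v k = w k) :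
    esymmPoly v j = esymmPoly w j :=
  prod_congr rfl fun k hk => by rw [h k hk]

lemma pow_sub_eq_inv_pow {z : ℂ} {n : ℕ} (hz : z ^ n = 1) {k : ℕ} (hk : k ≤ n) :
    z ^ (n - k) = z⁻¹ ^ k := by
  simpa using inv_pow_sub_eq (z := z⁻¹) (by simp [hz]) hk

lemma mul_squareSum {z : ℂ} {n : ℕ} (hn : 1 ≤ n) (hz : IsPrimitiveRoot z n) (a b : ℕ) :
    (n : ℂ) * squareSum (fun k => 1 / (1 - z ^ k)) n a b =
      ∑ p ∈ range n, ∑ q ∈ range n, splitCoeff z n (fun k => 1 / (1 - z ^ k)) p q *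
        ((p.choose a : ℂ) * (q.choose b : ℂ)) := by
  have key : ∀ j ∈ Ico 1 n, (n : ℂ) * ((1 / (1 - z ^ j)) ^ 2 *
      (esymmPoly (fun k => 1 / (1 - z ^ k)) j).coeff a *
      (∏ k ∈ Ico (j + 1) n, (1 + Polynomial.C (1 / (1 - z ^ k)) * Polynomial.X)).coeff b) =
      1 / (1 - z ^ j) * (((qFallingPoly z j).comp (Polynomial.X + 1)).coeff a *
        ((qFallingPoly z⁻¹ (n - j)).comp (Polynomial.X + 1)).coeff b) := by
    intro j hj
    rw [mem_Ico] at hj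
    have hj0 := one_sub_pow_ne_zero hz hj.1 hj.2
    have hB : ∏ k ∈ Ico (j + 1) n, (1 + Polynomial.C (1 / (1 - z ^ k)) * Polynomial.X) =
        esymmPoly (fun k => 1 / (1 - z⁻¹ ^ k)) (n - j) := by
      rw [← esymmPoly_reflect (fun k => 1 / (1 - z ^ k)) hj.2.le]
      refine esymmPoly_congr fun k hk => ?_
      rw [mem_Ico] at hk
      rw [pow_sub_eq_inv_pow hz.pow_eq_one (by omega)]
    have hD : ∏ k ∈ Ico 1 (n - j), (1 - z⁻¹ ^ k) = ∏ k ∈ Ico (j + 1) n, (1 - z ^ k) := by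
      rw [show Ico (j + 1) n = Ico (n + 1 - (n - j)) (n + 1 - 1) by congr 1; omega,
        ← prod_Ico_reflect (fun k => 1 - z ^ k) 1 (by omega)]
      refine prod_congr rfl fun k hk => ?_
      rw [mem_Ico] at hk
      rw [pow_sub_eq_inv_pow hz.pow_eq_one (by omega)]
    rw [hB, qFallingPoly_comp_X_add_one, qFallingPoly_comp_X_add_one, hD,
      Polynomial.coeff_C_mul, Polynomial.coeff_C_mul, ← prod_one_sub_pow_eq hn hz,
      ← prod_Ico_consecutive _ hj.1 hj.2.le, prod_eq_prod_Ico_succ_bot hj.2]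
    · field_simp
    · intro k hk
      rw [mem_Ico] at hk
      rw [← pow_sub_eq_inv_pow hz.pow_eq_one (by omega)]
      exact one_sub_pow_ne_zero hz (by omega) (by omega)
    · intro k hk
      rw [mem_Ico] at hk
      exact one_sub_pow_ne_zero hz hk.1 (by omega)
  rw [squareSum, mul_sum, sum_congr rfl key]
  simp only [splitCoeff, sum_mul]
  rw [sum_congr rfl fun p _ => sum_comm, sum_comm]
  refine sum_congr rfl fun j hj => ?_
  rw [mem_Ico] at hj
  rw [coeff_comp_X_add_one (n := n) ((natDegree_qFallingPoly z j).trans_lt (by omega)),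
    coeff_comp_X_add_one (n := n) ((natDegree_qFallingPoly z⁻¹ (n - j)).trans_lt (by omega)),
    sum_mul_sum, mul_sum]
  refine sum_congr rfl fun p _ => ?_
  rw [mul_sum]
  refine sum_congr rfl fun q _ => ?_
  ring

/-- The symmetrised sum `squareSum v n a b + squareSum v n b a` depends on `a + b` only. -/
lemma exists_squareSum_add_squareSum_eq {z : ℂ} {n : ℕ} (hn : 1 ≤ n) (hz : IsPrimitiveRoot z n) :
    ∃ κ : ℕ → ℂ, ∀ a b, squareSum (fun k => 1 / (1 - z ^ k)) n a b +
      squareSum (fun k => 1 / (1 - z ^ k)) n b a = κ (a + b) := by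
  set s := splitCoeff z n (fun k => 1 / (1 - z ^ k)) with hs
  have hσ : ∀ p q, s p q + s q p = s 0 (p + q) + s (p + q) 0 :=
    eq_zero_add_of_succ_eq (f := fun p q => s p q + s q p) (splitCoeff_symm_succ hn hz)
  have hn0 : (n : ℂ) ≠ 0 := by
    rw [Nat.cast_ne_zero]
    omega
  refine ⟨fun m => (∑ N ∈ range n, (s 0 N + s N 0) * ((N + 1).choose (m + 1) : ℂ)) / n,
    fun a b => ?_⟩
  rw [eq_div_iff hn0, mul_comm, mul_add, mul_squareSum hn hz, mul_squareSum hn hz b a,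
    sum_comm (f := fun p q => splitCoeff z n (fun k => 1 / (1 - z ^ k)) p q *
      ((p.choose b : ℂ) * (q.choose a : ℂ))), ← sum_add_distrib]
  trans ∑ p ∈ range n, ∑ q ∈ range (n - p),
    (s 0 (p + q) + s (p + q) 0) * ((p.choose a : ℂ) * (q.choose b : ℂ))
  · refine sum_congr rfl fun p _ => ?_
    rw [← sum_add_distrib]
    symm
    refine (sum_subset (range_mono (Nat.sub_le n p)) fun q _ hq => ?_).trans
      (sum_congr rfl fun q _ => ?_)
    · rw [mem_range] at hq
      rw [hs, splitCoeff_eq_zero_left z _ (p := p + q) (by omega),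
        splitCoeff_eq_zero_right z _ _ (q := p + q) (by omega)]
      simp
    · rw [← hσ]
      ring
  · rw [← sum_range_diag_flip n fun p q =>
      (s 0 (p + q) + s (p + q) 0) * ((p.choose a : ℂ) * (q.choose b : ℂ))]
    refine sum_congr rfl fun N _ => ?_
    rw [← sum_antidiagonal_choose_mul_choose, Nat.sum_antidiagonal_eq_sum_range_succ_mk]
    push_cast
    rw [mul_sum]
    refine sum_congr rfl fun p hp => ?_
    rw [Nat.add_sub_cancel' (Nat.le_of_lt_succ (mem_range.1 hp))]

lemma conj_coeff_prod (v : ℕ → ℂ) (t : Finset ℕ) (a : ℕ) :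
    (starRingEnd ℂ) ((∏ k ∈ t, (1 + Polynomial.C (v k) * Polynomial.X)).coeff a) =
      (∏ k ∈ t, (1 + Polynomial.C ((starRingEnd ℂ) (v k)) * Polynomial.X)).coeff a := by
  rw [← Polynomial.coeff_map, Polynomial.map_prod]
  simp

/-- Reversing the order of the indices exchanges `a` and `b`. -/
lemma conj_squareSum {v : ℕ → ℂ} {n : ℕ} (hv : ∀ k ∈ Ico 1 n, (starRingEnd ℂ) (v k) = v (n - k))
    (a b : ℕ) : (starRingEnd ℂ) (squareSum v n a b) = squareSum v n b a := by
  rcases Nat.eq_zero_or_pos n with rfl | hn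
  · simp [squareSum]
  have h := sum_Ico_reflect (fun j => v j ^ 2 * (esymmPoly v j).coeff b *
    (∏ k ∈ Ico (j + 1) n, (1 + Polynomial.C (v k) * Polynomial.X)).coeff a) 1 (Nat.le_succ n)
  rw [show n + 1 - n = 1 by omega, Nat.add_sub_cancel] at h
  rw [squareSum, squareSum, ← h, map_sum]
  refine sum_congr rfl fun j hj => ?_
  rw [map_mul, map_mul, map_pow, hv j hj, esymmPoly, conj_coeff_prod, conj_coeff_prod]
  rw [mem_Ico] at hj
  have h1 : ∏ k ∈ Ico 1 j, (1 + Polynomial.C ((starRingEnd ℂ) (v k)) * Polynomial.X) =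
      ∏ k ∈ Ico (n - j + 1) n, (1 + Polynomial.C (v k) * Polynomial.X) := by
    rw [← esymmPoly_reflect v (Nat.sub_le n j), Nat.sub_sub_self hj.2.le]
    refine esymmPoly_congr fun k hk => hv k ?_
    rw [mem_Ico] at hk ⊢
    omega
  have h2 : ∏ k ∈ Ico (j + 1) n, (1 + Polynomial.C ((starRingEnd ℂ) (v k)) * Polynomial.X) =
      esymmPoly v (n - j) := by
    rw [← esymmPoly_reflect (fun k => (starRingEnd ℂ) (v k)) hj.2.le]
    refine esymmPoly_congr fun k hk => ?_
    rw [mem_Ico] at hk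
    rw [hv _ (by rw [mem_Ico]; omega), Nat.sub_sub_self (by omega)]
  rw [h1, h2]
  ring

/-- Newton-type identity for the sum over all positions of the squared variable. -/
lemma sum_antidiagonal_squareSum (v : ℕ → ℂ) (n m : ℕ) :
    ∑ x ∈ antidiagonal m, squareSum v n x.1 x.2 =
      (∑ j ∈ Ico 1 n, v j) * (esymmPoly v n).coeff (m + 1) -
        (m + 2) * (esymmPoly v n).coeff (m + 2) := by
  let F : ℕ → Polynomial ℂ := fun k => 1 + Polynomial.C (v k) * Polynomial.X
  have hF : ∀ j ∈ Ico 1 n, esymmPoly v n =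
      (esymmPoly v j * ∏ k ∈ Ico (j + 1) n, F k) * F j := by
    intro j hj
    rw [mem_Ico] at hj
    rw [esymmPoly, ← prod_Ico_consecutive _ hj.1 hj.2.le, prod_eq_prod_Ico_succ_bot hj.2,
      esymmPoly]
    ring
  have hder : Polynomial.derivative (esymmPoly v n) = ∑ j ∈ Ico 1 n,
      (esymmPoly v j * ∏ k ∈ Ico (j + 1) n, F k) * Polynomial.C (v j) := by
    rw [esymmPoly, Polynomial.derivative_prod_finset]
    refine sum_congr rfl fun j hj => ?_
    have hne : F j ≠ 0 := fun h => by
      have := congrArg (Polynomial.eval 0) h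
      simp [F] at this
    have := hF j hj
    rw [esymmPoly, ← prod_erase_mul _ _ hj] at this
    rw [mul_right_cancel₀ hne this]
    simp
  have hco := congrArg (fun f => Polynomial.coeff f (m + 1)) hder
  simp only [Polynomial.coeff_derivative, Polynomial.finsetSum_coeff, Polynomial.coeff_mul_C]
    at hco
  rw [show ((m : ℂ) + 2) * (esymmPoly v n).coeff (m + 2) =
    (esymmPoly v n).coeff (m + 1 + 1) * (((m + 1 : ℕ) : ℂ) + 1) by push_cast; ring, hco, sum_mul,
    ← sum_sub_distrib]
  simp only [squareSum]
  rw [sum_comm]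
  refine sum_congr rfl fun j hj => ?_
  rw [hF j hj, coeff_mul_one_add_C_mul_X, Polynomial.coeff_mul _ _ m]
  simp only [mul_assoc]
  rw [← mul_sum]
  ring

theorem re_qmzv_one_two (n m a b : ℕ) (hn : 2 ≤ n)
    (hm : m = a + b + 1) (hm2 : 2 ≤ m)
    (ζ : ℂ) (hζ : ζ = Complex.exp (2 * Real.pi * Complex.I / n))
    (u : ℕ → ℂ) (hu : ∀ k, u k = 1 / (1 - ζ ^ k)) :
    (∑ i ∈ (Fintype.piFinset fun _ : Fin m => Finset.Icc 1 (n - 1)).filter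
          (fun i => StrictMono i),
        ∏ r, u (i r) ^ (if (r : ℕ) = a then 2 else 1)).re =
      -((m.factorial : ℝ) * ((n : ℝ) - 2 * m - 3) / (2 * ((m + 2).factorial : ℝ))) *
        (Nat.choose (n - 1) m : ℝ) := by
  have hn1 : 1 ≤ n := by omega
  have hn0 : (n : ℂ) ≠ 0 := Nat.cast_ne_zero.2 (by omega)
  have hz : IsPrimitiveRoot ζ n := hζ ▸ Complex.isPrimitiveRoot_exp n (by omega)
  obtain rfl : u = fun k => 1 / (1 - ζ ^ k) := funext hu
  set u : ℕ → ℂ := fun k => 1 / (1 - ζ ^ k) with hu'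
  subst hm
  have hS : ∑ i ∈ (Fintype.piFinset fun _ : Fin (a + b + 1) => Finset.Icc 1 (n - 1)).filter
      (fun i => StrictMono i), ∏ r, u (i r) ^ (if (r : ℕ) = a then 2 else 1) =
      squareSum u n a b := by
    have h := sum_strictMonoTuples_eq_sum_coeff u a b (n - 1)
    rw [Nat.sub_add_cancel hn1] at h
    exact h
  have hconj : ∀ k ∈ Ico 1 n, (starRingEnd ℂ) (u k) = u (n - k) := by
    intro k hk
    rw [mem_Ico] at hk
    simp only [hu', map_div₀, map_one, map_sub, map_pow]
    rw [pow_sub_eq_inv_pow hz.pow_eq_one hk.2.le,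
      Complex.inv_eq_conj (Complex.norm_eq_one_of_pow_eq_one hz.pow_eq_one (by omega))]
  have hsum : ∑ j ∈ Ico 1 n, u j = (esymmPoly u n).coeff 1 := by
    have h : ∀ N, ∑ j ∈ Ico 1 (N + 1), u j = (esymmPoly u (N + 1)).coeff 1 ∧
        (esymmPoly u (N + 1)).coeff 0 = 1 := by
      intro N
      induction N with
      | zero => simp [esymmPoly, Polynomial.coeff_one]
      | succ N ih =>
        rw [sum_Ico_succ_top (Nat.le_add_left 1 N), esymmPoly_succ u (Nat.le_add_left 1 N),
          coeff_mul_one_add_C_mul_X, coeff_mul_one_add_C_mul_X_zero, ih.1, ih.2]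
        simp
    have := (h (n - 1)).1
    rwa [Nat.sub_add_cancel hn1] at this
  obtain ⟨κ, hκ⟩ := exists_squareSum_add_squareSum_eq hn1 hz
  have htot := sum_antidiagonal_squareSum u n (a + b)
  have htot2 : (2 : ℂ) * ∑ x ∈ antidiagonal (a + b), squareSum u n x.1 x.2 =
      (a + b + 1 : ℕ) * κ (a + b) := by
    rw [two_mul]
    nth_rewrite 2 [← Nat.sum_antidiagonal_swap]
    rw [← sum_add_distrib, sum_congr rfl (g := fun _ => κ (a + b))]
    · simp
    · intro x hx
      rw [HasAntidiagonal.mem_antidiagonal] at hx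
      rw [← hx]
      exact hκ x.1 x.2
  have hre : ((2 * (squareSum u n a b).re : ℝ) : ℂ) = κ (a + b) := by
    rw [← hκ a b, ← conj_squareSum hconj a b, Complex.add_conj]
  have e1 := coeff_esymmPoly_eq hn1 hz 1
  have e2 := coeff_esymmPoly_eq hn1 hz (a + b + 1)
  have e3 := coeff_esymmPoly_eq hn1 hz (a + b + 2)
  have hE1 : (esymmPoly u n).coeff 1 = ((n : ℂ) - 1) / 2 := by
    rw [Nat.cast_choose_two] at e1
    refine mul_left_cancel₀ hn0 (e1.trans ?_)
    ring
  have hm0 : ((a : ℂ) + b + 1) ≠ 0 := by exact_mod_cast Nat.succ_ne_zero (a + b)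
  have hm1 : ((a : ℂ) + b + 1 + 1) ≠ 0 := by exact_mod_cast Nat.succ_ne_zero (a + b + 1)
  have hm2' : ((a : ℂ) + b + 1 + 2) ≠ 0 := by exact_mod_cast Nat.succ_ne_zero (a + b + 1 + 1)
  obtain ⟨N, rfl⟩ : ∃ N, n = N + 1 := ⟨n - 1, by omega⟩
  have hc1 : ((N + 1 : ℕ) : ℂ) * (N.choose (a + b + 1) : ℂ) =
      ((N + 1).choose (a + b + 1 + 1) : ℂ) * ((a : ℂ) + b + 1 + 1) := by
    exact_mod_cast Nat.add_one_mul_choose_eq N (a + b + 1)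
  have hc2 : ((N + 1 : ℕ) : ℂ) * (N.choose (a + b + 2) : ℂ) =
      ((N + 1).choose (a + b + 2 + 1) : ℂ) * ((a : ℂ) + b + 1 + 2) := by
    exact_mod_cast Nat.add_one_mul_choose_eq N (a + b + 2)
  have hc3 : (N.choose (a + b + 2) : ℂ) * ((a : ℂ) + b + 1 + 1) =
      (N.choose (a + b + 1) : ℂ) * ((N : ℂ) - (a + b + 1)) := by
    rcases le_or_gt (a + b + 1) N with h | h
    · have := Nat.choose_succ_right_eq N (a + b + 1)
      have h' := congrArg (Nat.cast : ℕ → ℂ) this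
      push_cast [Nat.cast_sub h] at h'
      exact h'
    · simp [Nat.choose_eq_zero_of_lt h, Nat.choose_eq_zero_of_lt (h.trans (Nat.lt_succ_self _))]
  have hE2 : (esymmPoly u (N + 1)).coeff (a + b + 1) =
      (N.choose (a + b + 1) : ℂ) / ((a : ℂ) + b + 1 + 1) := by
    rw [eq_div_iff hm1]
    refine mul_left_cancel₀ hn0 ?_
    rw [hc1, ← e2]
    ring
  have hE3 : (esymmPoly u (N + 1)).coeff (a + b + 2) =
      (N.choose (a + b + 1) : ℂ) * ((N : ℂ) - (a + b + 1)) /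
        (((a : ℂ) + b + 1 + 1) * ((a : ℂ) + b + 1 + 2)) := by
    rw [eq_div_iff (mul_ne_zero hm1 hm2'), ← hc3]
    refine mul_left_cancel₀ hn0 ?_
    linear_combination ((a : ℂ) + b + 1 + 1) * ((a : ℂ) + b + 1 + 2) * e3 -
      ((a : ℂ) + b + 1 + 1) * hc2
  have hfac : (((a + b + 1 + 2).factorial : ℕ) : ℝ) =
      ((a : ℝ) + b + 1 + 2) * (((a : ℝ) + b + 1 + 1) * ((a + b + 1).factorial : ℝ)) := by
    rw [Nat.factorial_succ, Nat.factorial_succ]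
    push_cast
    ring
  rw [htot, ← hre, hsum, hE1, hE2, hE3] at htot2
  rw [hS, hfac, Nat.add_sub_cancel]
  rw [← Complex.ofReal_inj]
  push_cast at htot2 ⊢
  have hf0' : ((a + b + 1).factorial : ℂ) ≠ 0 := Nat.cast_ne_zero.2 (Nat.factorial_ne_zero _)
  refine mul_left_cancel₀ (mul_ne_zero two_ne_zero hm0) ?_
  rw [show 2 * ((a : ℂ) + b + 1) * ((squareSum u (N + 1) a b).re : ℂ) =
    ((a : ℂ) + b + 1) * (2 * ((squareSum u (N + 1) a b).re : ℂ)) by ring, ← htot2]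
  field_simp
  ring
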